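/- Let M, a be reals with 0 ≤ a < M, let k, α, β be real constants with sin k ≠ 0, and define Θ = β + α( a cosθ cos k / sin k + t ) on U. Let u : U → ℝ be a positive C² function depending only on (r,θ) with ∂_r u / u = (M − r − α(r²+a²))/Δ and ∂_θ u / u = −cotθ. Then the 2-form F₁₀A = (u/√Δ)[ a sinθ sin k sinhΘ dt∧dr + Δ cos k coshΘ dt∧dθ − Δ sin k sinθ coshΘ dt∧dφ − ρ² cos k sinhΘ dr∧dθ + (r²+a²) sin k sinθ sinhΘ dr∧dφ + aΔ cos k sin²θ coshΘ dθ∧dφ ] is closed and force-free on U (F_{μν} j^ν = 0 for its current density j), and F₁₀A² := g^{μα}g^{νβ}F_{αβ}F_{μν} = −2u², so F₁₀A is electrically dominated. -/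

import Mathlib

noncomputable section

/-- Partial derivative of `f` in the coordinate direction `μ`,
coordinates `(x 0, x 1, x 2, x 3) = (t, r, θ, φ)`. -/
def pd (μ : Fin 4) (f : (Fin 4 → ℝ) → ℝ) (x : Fin 4 → ℝ) : ℝ :=
  fderiv ℝ f x (Pi.single μ 1)

/-- ρ² = r² + a² cos²θ. -/
def rho2 (a : ℝ) (x : Fin 4 → ℝ) : ℝ := (x 1) ^ 2 + a ^ 2 * Real.cos (x 2) ^ 2

/-- Δ = r² − 2Mr + a². -/
def Del (M a : ℝ) (x : Fin 4 → ℝ) : ℝ := (x 1) ^ 2 - 2 * M * (x 1) + a ^ 2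

/-- Σ² = (r²+a²)² − Δ a² sin²θ. -/
def Sig2 (M a : ℝ) (x : Fin 4 → ℝ) : ℝ :=
  ((x 1) ^ 2 + a ^ 2) ^ 2 - Del M a x * a ^ 2 * Real.sin (x 2) ^ 2

/-- The Kerr metric in Boyer–Lindquist coordinates `(t, r, θ, φ)`. -/
def kerr (M a : ℝ) (x : Fin 4 → ℝ) : Matrix (Fin 4) (Fin 4) ℝ :=
  Matrix.of fun μ ν =>
    if μ = 0 ∧ ν = 0 then -1 + 2 * M * (x 1) / rho2 a x
    else if (μ = 0 ∧ ν = 3) ∨ (μ = 3 ∧ ν = 0) then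
      -(2 * M * (x 1) * a * Real.sin (x 2) ^ 2) / rho2 a x
    else if μ = 1 ∧ ν = 1 then rho2 a x / Del M a x
    else if μ = 2 ∧ ν = 2 then rho2 a x
    else if μ = 3 ∧ ν = 3 then Sig2 M a x * Real.sin (x 2) ^ 2 / rho2 a x
    else 0

/-- The exterior Kerr domain U = {r > r₊, 0 < θ < π}. -/
def KerrExt (M a : ℝ) : Set (Fin 4 → ℝ) :=
  {x | M + Real.sqrt (M ^ 2 - a ^ 2) < x 1 ∧ 0 < x 2 ∧ x 2 < Real.pi}

/-- `wedge μ ν f` is the antisymmetric matrix of the 2-form `f dx^μ ∧ dx^ν`. -/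
def wedge (μ ν : Fin 4) (f : ℝ) : Matrix (Fin 4) (Fin 4) ℝ :=
  Matrix.of fun i j => if i = μ ∧ j = ν then f else if i = ν ∧ j = μ then -f else 0

/-- A 2-form `F` is closed on `S`: ∂_μ F_{νλ} + ∂_ν F_{λμ} + ∂_λ F_{μν} = 0. -/
def Closed2Form (F : (Fin 4 → ℝ) → Matrix (Fin 4) (Fin 4) ℝ) (S : Set (Fin 4 → ℝ)) : Prop :=
  ∀ x ∈ S, ∀ μ ν lam : Fin 4,
    pd μ (fun y => F y ν lam) x + pd ν (fun y => F y lam μ) x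
      + pd lam (fun y => F y μ ν) x = 0

/-- Current density j^μ = (ρ²sinθ)⁻¹ ∂_ν (ρ²sinθ g^{μα} g^{νβ} F_{αβ}). -/
def current (M a : ℝ) (F : (Fin 4 → ℝ) → Matrix (Fin 4) (Fin 4) ℝ)
    (x : Fin 4 → ℝ) (μ : Fin 4) : ℝ :=
  (rho2 a x * Real.sin (x 2))⁻¹ *
    ∑ ν : Fin 4, pd ν (fun y => rho2 a y * Real.sin (y 2) *
      ∑ i : Fin 4, ∑ j : Fin 4, (kerr M a y)⁻¹ μ i * (kerr M a y)⁻¹ ν j * F y i j) x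

/-- `F` is force-free on `S`: F_{μν} j^ν = 0 for the current density `j` of `F`. -/
def ForceFree (M a : ℝ) (F : (Fin 4 → ℝ) → Matrix (Fin 4) (Fin 4) ℝ)
    (S : Set (Fin 4 → ℝ)) : Prop :=
  ∀ x ∈ S, ∀ μ : Fin 4, ∑ ν : Fin 4, F x μ ν * current M a F x ν = 0

/-- The invariant F² = g^{μα} g^{νβ} F_{αβ} F_{μν}. -/
def Fsq (M a : ℝ) (F : (Fin 4 → ℝ) → Matrix (Fin 4) (Fin 4) ℝ) (x : Fin 4 → ℝ) : ℝ :=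
  ∑ μ : Fin 4, ∑ ν : Fin 4, ∑ i : Fin 4, ∑ j : Fin 4,
    (kerr M a x)⁻¹ μ i * (kerr M a x)⁻¹ ν j * F x i j * F x μ ν

/-- Θ = β + α( a cosθ cos k / sin k + t ). -/
def ThA (a k α β : ℝ) (x : Fin 4 → ℝ) : ℝ :=
  β + α * (a * Real.cos (x 2) * Real.cos k / Real.sin k + x 0)

/-- The 2-form F₁₀A. -/
def F10A (M a k α β : ℝ) (u : ℝ × ℝ → ℝ) (x : Fin 4 → ℝ) : Matrix (Fin 4) (Fin 4) ℝ :=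
  let TH := ThA a k α β
  wedge 0 1 (u (x 1, x 2) / Real.sqrt (Del M a x) *
      (a * Real.sin (x 2) * Real.sin k * Real.sinh (TH x)))
    + wedge 0 2 (u (x 1, x 2) / Real.sqrt (Del M a x) *
      (Del M a x * Real.cos k * Real.cosh (TH x)))
    + wedge 0 3 (u (x 1, x 2) / Real.sqrt (Del M a x) *
      (-(Del M a x * Real.sin k * Real.sin (x 2) * Real.cosh (TH x))))
    + wedge 1 2 (u (x 1, x 2) / Real.sqrt (Del M a x) *
      (-(rho2 a x * Real.cos k * Real.sinh (TH x))))
    + wedge 1 3 (u (x 1, x 2) / Real.sqrt (Del M a x) *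
      (((x 1) ^ 2 + a ^ 2) * Real.sin k * Real.sin (x 2) * Real.sinh (TH x)))
    + wedge 2 3 (u (x 1, x 2) / Real.sqrt (Del M a x) *
      (a * Del M a x * Real.cos k * Real.sin (x 2) ^ 2 * Real.cosh (TH x)))


/-! ### Helper calculus -/

/-- `f` is differentiable at `x` with coordinate derivatives `d`. -/
def HPD (f : (Fin 4 → ℝ) → ℝ) (d : Fin 4 → ℝ) (x : Fin 4 → ℝ) : Prop :=
  DifferentiableAt ℝ f x ∧ ∀ μ, pd μ f x = d μ

theorem HPD.mul {f g : (Fin 4 → ℝ) → ℝ} {d e x : Fin 4 → ℝ} (hf : HPD f d x) (hg : HPD g e x) :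
    HPD (fun y => f y * g y) (fun μ => d μ * g x + f x * e μ) x := by
  refine ⟨hf.1.mul hg.1, fun μ => ?_⟩
  have h := (hf.1.hasFDerivAt.mul hg.1.hasFDerivAt).fderiv
  have h2 : pd μ (fun y => f y * g y) x = f x * pd μ g x + g x * pd μ f x := by
    unfold pd
    have h3 : (fun y => f y * g y) = f * g := rfl
    rw [h3, h]; simp
  rw [h2, hf.2, hg.2]; ring

theorem HPD.add {f g : (Fin 4 → ℝ) → ℝ} {d e x : Fin 4 → ℝ} (hf : HPD f d x) (hg : HPD g e x) :
    HPD (fun y => f y + g y) (fun μ => d μ + e μ) x := by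
  refine ⟨hf.1.add hg.1, fun μ => ?_⟩
  have h := (hf.1.hasFDerivAt.add hg.1.hasFDerivAt).fderiv
  have h2 : pd μ (fun y => f y + g y) x = pd μ f x + pd μ g x := by
    unfold pd
    have h3 : (fun y => f y + g y) = f + g := rfl
    rw [h3, h]; simp
  rw [h2, hf.2, hg.2]

theorem HPD.const (c : ℝ) (x : Fin 4 → ℝ) : HPD (fun _ => c) (fun _ => 0) x :=
  ⟨differentiableAt_const c, fun μ => by simp [pd]⟩

theorem HPD.coord (i : Fin 4) (x : Fin 4 → ℝ) :
    HPD (fun y => y i) (fun μ => if i = μ then 1 else 0) x := by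
  refine ⟨by fun_prop, fun μ => ?_⟩
  have h := (hasFDerivAt_apply (𝕜 := ℝ) (F' := fun _ : Fin 4 => ℝ) i x).fderiv
  unfold pd
  rw [h]; simp [Pi.single_apply]

theorem HPD.comp {f : (Fin 4 → ℝ) → ℝ} {d x : Fin 4 → ℝ} {h : ℝ → ℝ} {h' : ℝ}
    (hh : HasDerivAt h h' (f x)) (hf : HPD f d x) :
    HPD (fun y => h (f y)) (fun μ => h' * d μ) x := by
  have hc := hh.comp_hasFDerivAt x hf.1.hasFDerivAt
  refine ⟨hc.differentiableAt, fun μ => ?_⟩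
  have := hc.fderiv
  show _ = h' * d μ
  rw [← hf.2]
  unfold pd
  have h3 : (fun y => h (f y)) = h ∘ f := rfl
  rw [h3, this]; simp

theorem HPD.congr {f : (Fin 4 → ℝ) → ℝ} {d e x : Fin 4 → ℝ} (hf : HPD f d x)
    (h : ∀ μ, d μ = e μ) : HPD f e x := ⟨hf.1, fun μ => (hf.2 μ).trans (h μ)⟩

theorem HPD.congrf {f g : (Fin 4 → ℝ) → ℝ} {d x : Fin 4 → ℝ} (hf : HPD f d x)
    (h : ∀ y, g y = f y) : HPD g d x := by
  have : g = f := funext h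
  rw [this]; exact hf

theorem HPD.neg {f : (Fin 4 → ℝ) → ℝ} {d x : Fin 4 → ℝ} (hf : HPD f d x) :
    HPD (fun y => -f y) (fun μ => -d μ) x :=
  (((HPD.const (-1) x).mul hf).congr (fun μ => by ring)).congrf (fun y => by ring)

theorem pd_congr {f g : (Fin 4 → ℝ) → ℝ} {x : Fin 4 → ℝ} (h : f =ᶠ[nhds x] g) (μ : Fin 4) :
    pd μ f x = pd μ g x := by
  unfold pd; rw [h.fderiv_eq]

theorem isOpen_kerrExt (M a : ℝ) : IsOpen (KerrExt M a) := by
  apply IsOpen.inter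
  · exact isOpen_lt continuous_const (continuous_apply 1)
  · exact (isOpen_lt continuous_const (continuous_apply 2)).inter
      (isOpen_lt (continuous_apply 2) continuous_const)

theorem del_pos {M a : ℝ} (ha : 0 ≤ a) (haM : a < M) {x : Fin 4 → ℝ} (hx : x ∈ KerrExt M a) :
    0 < Del M a x := by
  have h1 : M + Real.sqrt (M ^ 2 - a ^ 2) < x 1 := hx.1
  have h2 := Real.sqrt_nonneg (M ^ 2 - a ^ 2)
  have h3 : Real.sqrt (M ^ 2 - a ^ 2) ^ 2 = M ^ 2 - a ^ 2 := Real.sq_sqrt (by nlinarith)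
  unfold Del
  nlinarith

theorem r_pos {M a : ℝ} (ha : 0 ≤ a) (haM : a < M) {x : Fin 4 → ℝ} (hx : x ∈ KerrExt M a) :
    0 < x 1 := by
  have h1 : M + Real.sqrt (M ^ 2 - a ^ 2) < x 1 := hx.1
  have h2 := Real.sqrt_nonneg (M ^ 2 - a ^ 2)
  linarith

theorem rho2_pos {M a : ℝ} (ha : 0 ≤ a) (haM : a < M) {x : Fin 4 → ℝ} (hx : x ∈ KerrExt M a) :
    0 < rho2 a x := by
  have := r_pos ha haM hx
  unfold rho2; positivity

theorem sin_pos_ext {M a : ℝ} {x : Fin 4 → ℝ} (hx : x ∈ KerrExt M a) : 0 < Real.sin (x 2) :=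
  Real.sin_pos_of_pos_of_lt_pi hx.2.1 hx.2.2

/-- Explicit inverse metric. -/
def kinv (M a : ℝ) (x : Fin 4 → ℝ) : Matrix (Fin 4) (Fin 4) ℝ :=
  !![-(Sig2 M a x) / (rho2 a x * Del M a x), 0, 0, -(2 * M * x 1 * a) / (rho2 a x * Del M a x);
    0, Del M a x / rho2 a x, 0, 0;
    0, 0, 1 / rho2 a x, 0;
    -(2 * M * x 1 * a) / (rho2 a x * Del M a x), 0, 0,
      (Del M a x - a ^ 2 * Real.sin (x 2) ^ 2) / (rho2 a x * Del M a x * Real.sin (x 2) ^ 2)]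

theorem kerr_inv {M a : ℝ} (ha : 0 ≤ a) (haM : a < M) {x : Fin 4 → ℝ} (hx : x ∈ KerrExt M a) :
    (kerr M a x)⁻¹ = kinv M a x := by
  apply Matrix.inv_eq_right_inv
  have hD := (del_pos ha haM hx).ne'
  have hR := (rho2_pos ha haM hx).ne'
  have hS := (sin_pos_ext hx).ne'
  have hc : Real.cos (x 2) ^ 2 = 1 - Real.sin (x 2) ^ 2 := by
    have := Real.sin_sq_add_cos_sq (x 2); linarith
  have e1 : rho2 a x = x 1 ^ 2 + a ^ 2 * (1 - Real.sin (x 2) ^ 2) := by rw [rho2, hc]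
  have e2 : 2 * M * x 1 = x 1 ^ 2 + a ^ 2 - Del M a x := by unfold Del; ring
  have e3 : Sig2 M a x = (x 1 ^ 2 + a ^ 2) ^ 2 - Del M a x * a ^ 2 * Real.sin (x 2) ^ 2 := rfl
  have key : ∀ D R G s : ℝ, D ≠ 0 → R ≠ 0 → s ≠ 0 →
      R = x 1 ^ 2 + a ^ 2 * (1 - s ^ 2) → 2 * M * x 1 = x 1 ^ 2 + a ^ 2 - D →
      G = (x 1 ^ 2 + a ^ 2) ^ 2 - D * a ^ 2 * s ^ 2 →
      (Matrix.of ![![-1 + 2 * M * (x 1) / R, 0, 0, -(2 * M * (x 1) * a * s ^ 2) / R],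
        ![0, R / D, 0, 0], ![0, 0, R, 0],
        ![-(2 * M * (x 1) * a * s ^ 2) / R, 0, 0, G * s ^ 2 / R]]) *
      !![-G / (R * D), 0, 0, -(2 * M * x 1 * a) / (R * D);
        0, D / R, 0, 0;
        0, 0, 1 / R, 0;
        -(2 * M * x 1 * a) / (R * D), 0, 0,
        (D - a ^ 2 * s ^ 2) / (R * D * s ^ 2)] = 1 := by
    intro D R G s hD hR hs e1 e2 e3
    rw [e2]
    ext i j
    fin_cases i <;> fin_cases j <;>
      simp [Matrix.mul_apply, Fin.sum_univ_four, hD, hR]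
    all_goals field_simp
    all_goals subst e3; rw [e1]; ring
  rw [← key _ _ _ _ hD hR hS e1 e2 e3, kinv]
  congr 1
  ext i j
  fin_cases i <;> fin_cases j <;> simp [kerr]

/-! ### The field, its dual density and their derivatives -/

/-- The factor `u / √Δ`. -/
def Vf (M a : ℝ) (u : ℝ × ℝ → ℝ) (y : Fin 4 → ℝ) : ℝ :=
  u (y 1, y 2) / Real.sqrt (Del M a y)

/-- The factor `u / √Δ cosh Θ`. -/
def Cf (M a k α β : ℝ) (u : ℝ × ℝ → ℝ) (y : Fin 4 → ℝ) : ℝ :=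
  Vf M a u y * Real.cosh (ThA a k α β y)

/-- The factor `u / √Δ sinh Θ`. -/
def Sf (M a k α β : ℝ) (u : ℝ × ℝ → ℝ) (y : Fin 4 → ℝ) : ℝ :=
  Vf M a u y * Real.sinh (ThA a k α β y)

/-- antisymmetric matrix with given upper entries -/
def asym (p q r s t w : ℝ) : Matrix (Fin 4) (Fin 4) ℝ :=
  !![0, p, q, r; -p, 0, s, t; -q, -s, 0, w; -r, -t, -w, 0]

theorem F10A_eq (M a k α β : ℝ) (u : ℝ × ℝ → ℝ) (y : Fin 4 → ℝ) :
    F10A M a k α β u y = asym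
      (a * Real.sin k * (Real.sin (y 2) * Sf M a k α β u y))
      (Real.cos k * (Del M a y * Cf M a k α β u y))
      (-Real.sin k * (Del M a y * Real.sin (y 2) * Cf M a k α β u y))
      (-Real.cos k * (rho2 a y * Sf M a k α β u y))
      (Real.sin k * ((y 1 * y 1 + a ^ 2) * Real.sin (y 2) * Sf M a k α β u y))
      (a * Real.cos k * (Del M a y * (Real.sin (y 2) * Real.sin (y 2)) * Cf M a k α β u y)) := by
  ext i j
  fin_cases i <;> fin_cases j <;> simp [F10A, wedge, asym, Sf, Cf, Vf] <;> ring

theorem dual_eq {M a k α β : ℝ} (ha : 0 ≤ a) (haM : a < M) (u : ℝ × ℝ → ℝ)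
    {y : Fin 4 → ℝ} (hy : y ∈ KerrExt M a) (μ ν : Fin 4) :
    rho2 a y * Real.sin (y 2) *
      ∑ i : Fin 4, ∑ j : Fin 4,
        (kerr M a y)⁻¹ μ i * (kerr M a y)⁻¹ ν j * F10A M a k α β u y i j = asym
      (-(a * Real.sin k) * (Del M a y * (Real.sin (y 2) * Real.sin (y 2)) * Sf M a k α β u y))
      (-Real.cos k * ((y 1 * y 1 + a ^ 2) * Real.sin (y 2) * Cf M a k α β u y))
      (Real.sin k * (rho2 a y * Cf M a k α β u y))
      (-Real.cos k * (Del M a y * Real.sin (y 2) * Sf M a k α β u y))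
      (Real.sin k * (Del M a y * Sf M a k α β u y))
      (a * Real.cos k * (Real.sin (y 2) * Cf M a k α β u y)) μ ν := by
  rw [kerr_inv ha haM hy, F10A_eq, kinv]
  have hD := (del_pos ha haM hy).ne'
  have hR := (rho2_pos ha haM hy).ne'
  have hS := (sin_pos_ext hy).ne'
  have hc : Real.cos (y 2) ^ 2 = 1 - Real.sin (y 2) ^ 2 := by
    have := Real.sin_sq_add_cos_sq (y 2); linarith
  have e1 : rho2 a y = y 1 ^ 2 + a ^ 2 * (1 - Real.sin (y 2) ^ 2) := by rw [rho2, hc]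
  have e2 : 2 * M * y 1 = y 1 ^ 2 + a ^ 2 - Del M a y := by unfold Del; ring
  have e3 : Sig2 M a y = (y 1 ^ 2 + a ^ 2) ^ 2 - Del M a y * a ^ 2 * Real.sin (y 2) ^ 2 := rfl
  rw [e3, e2]
  clear e3 e2 hc
  generalize Del M a y = D at *
  generalize rho2 a y = R at *
  generalize Real.sin (y 2) = s at *
  generalize Sf M a k α β u y = S at *
  generalize Cf M a k α β u y = C at *
  generalize Real.sin k = sk at *
  generalize Real.cos k = ck at *
  generalize y 1 = r at *
  fin_cases μ <;> fin_cases ν <;> simp [asym, Fin.sum_univ_four]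
  all_goals field_simp
  all_goals try subst e1
  all_goals first | (refine Or.inr ?_; ring) | ring

theorem u_HPD {M a α : ℝ} {u : ℝ × ℝ → ℝ}
    (hu : ContDiffOn ℝ 2 u
      (Set.Ioi (M + Real.sqrt (M ^ 2 - a ^ 2)) ×ˢ Set.Ioo 0 Real.pi))
    (hur : ∀ p ∈ Set.Ioi (M + Real.sqrt (M ^ 2 - a ^ 2)) ×ˢ Set.Ioo 0 Real.pi,
      fderiv ℝ u p (1, 0)
        = u p * ((M - p.1 - α * (p.1 ^ 2 + a ^ 2)) / (p.1 ^ 2 - 2 * M * p.1 + a ^ 2)))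
    (hut : ∀ p ∈ Set.Ioi (M + Real.sqrt (M ^ 2 - a ^ 2)) ×ˢ Set.Ioo 0 Real.pi,
      fderiv ℝ u p (0, 1) = u p * (-(Real.cos p.2 / Real.sin p.2)))
    {x : Fin 4 → ℝ} (hx : x ∈ KerrExt M a) :
    HPD (fun y => u (y 1, y 2))
      ![0, u (x 1, x 2) * ((M - x 1 - α * (x 1 ^ 2 + a ^ 2)) / Del M a x),
        u (x 1, x 2) * (-(Real.cos (x 2) / Real.sin (x 2))), 0] x := by
  have hp : (x 1, x 2) ∈ Set.Ioi (M + Real.sqrt (M ^ 2 - a ^ 2)) ×ˢ Set.Ioo 0 Real.pi :=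
    ⟨hx.1, hx.2⟩
  have hopen : IsOpen (Set.Ioi (M + Real.sqrt (M ^ 2 - a ^ 2)) ×ˢ Set.Ioo 0 Real.pi) :=
    isOpen_Ioi.prod isOpen_Ioo
  have hd : DifferentiableAt ℝ u (x 1, x 2) :=
    (hu.contDiffAt (hopen.mem_nhds hp)).differentiableAt (by norm_num)
  have h1 := hasFDerivAt_apply (𝕜 := ℝ) (F' := fun _ : Fin 4 => ℝ) 1 x
  have h2 := hasFDerivAt_apply (𝕜 := ℝ) (F' := fun _ : Fin 4 => ℝ) 2 x
  have hc := HasFDerivAt.comp (f := fun y : Fin 4 → ℝ => (y 1, y 2)) x hd.hasFDerivAt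
    (h1.prodMk h2)
  have hR := hur _ hp
  have hT := hut _ hp
  refine ⟨hc.differentiableAt, fun μ => ?_⟩
  have h3 : (fun y : Fin 4 → ℝ => u (y 1, y 2)) = u ∘ (fun y => (y 1, y 2)) := rfl
  have h4 : (0 : ℝ × ℝ) = (0, 0) := rfl
  unfold pd
  rw [h3, hc.fderiv]
  fin_cases μ
  · simp [← h4]
  · simpa [Del] using hR
  · simpa using hT
  · simp [← h4]

theorem del_HPD (M a : ℝ) (x : Fin 4 → ℝ) : HPD (Del M a) ![0, 2 * (x 1 - M), 0, 0] x := by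
  have h1 := HPD.coord 1 x
  refine ((((h1.mul h1).add ((HPD.const (-2 * M) x).mul h1)).add
    (HPD.const (a ^ 2) x)).congr ?_).congrf ?_
  · intro μ; fin_cases μ <;> simp <;> ring
  · intro y; simp only [Del]; ring

theorem rho2_HPD (a : ℝ) (x : Fin 4 → ℝ) :
    HPD (rho2 a) ![0, 2 * x 1, -2 * a ^ 2 * Real.cos (x 2) * Real.sin (x 2), 0] x := by
  have h1 := HPD.coord 1 x
  have h2 := HPD.comp (Real.hasDerivAt_cos (x 2)) (HPD.coord 2 x)
  refine (((h1.mul h1).add ((HPD.const (a ^ 2) x).mul (h2.mul h2))).congr ?_).congrf ?_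
  · intro μ; fin_cases μ <;> simp <;> ring
  · intro y; simp only [rho2]; ring

theorem sin_HPD (x : Fin 4 → ℝ) :
    HPD (fun y => Real.sin (y 2)) ![0, 0, Real.cos (x 2), 0] x := by
  refine (HPD.comp (Real.hasDerivAt_sin (x 2)) (HPD.coord 2 x)).congr ?_
  intro μ; fin_cases μ <;> simp

theorem ra_HPD (a : ℝ) (x : Fin 4 → ℝ) :
    HPD (fun y => y 1 * y 1 + a ^ 2) ![0, 2 * x 1, 0, 0] x := by
  have h1 := HPD.coord 1 x
  refine ((h1.mul h1).add (HPD.const (a ^ 2) x)).congr ?_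
  intro μ; fin_cases μ <;> simp <;> ring

theorem Th_HPD (a k α β : ℝ) (x : Fin 4 → ℝ) :
    HPD (ThA a k α β) ![α, 0, -(α * a * Real.sin (x 2) * (Real.cos k / Real.sin k)), 0] x := by
  have h0 := HPD.coord 0 x
  have h2 := HPD.comp (Real.hasDerivAt_cos (x 2)) (HPD.coord 2 x)
  refine (((HPD.const β x).add (((HPD.const α x).mul h0).add
    ((HPD.const (α * a * (Real.cos k / Real.sin k)) x).mul h2))).congr ?_).congrf ?_
  · intro μ; fin_cases μ <;> simp <;> ring
  · intro y; simp only [ThA]; ring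

theorem V_HPD {M a α : ℝ} (ha : 0 ≤ a) (haM : a < M) {u : ℝ × ℝ → ℝ} {x : Fin 4 → ℝ}
    (hx : x ∈ KerrExt M a)
    (h : HPD (fun y => u (y 1, y 2))
      ![0, u (x 1, x 2) * ((M - x 1 - α * (x 1 ^ 2 + a ^ 2)) / Del M a x),
        u (x 1, x 2) * (-(Real.cos (x 2) / Real.sin (x 2))), 0] x) :
    HPD (Vf M a u)
      ![0, Vf M a u x * ((2 * (M - x 1) - α * (x 1 ^ 2 + a ^ 2)) / Del M a x),
        -(Real.cos (x 2) / Real.sin (x 2)) * Vf M a u x, 0] x := by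
  have hD := del_pos ha haM hx
  have hs : Real.sqrt (Del M a x) ≠ 0 := (Real.sqrt_pos.2 hD).ne'
  have hsq : Real.sqrt (Del M a x) ^ 2 = Del M a x := Real.sq_sqrt hD.le
  have hq := HPD.comp ((Real.hasDerivAt_sqrt hD.ne').inv hs) (del_HPD M a x)
  refine ((h.mul hq).congr ?_).congrf ?_
  · intro μ
    fin_cases μ
    · simp
    · simp [Vf]
      rw [hsq]
      field_simp
      ring
    · simp [Vf]; ring
    · simp
  · intro y; simp [Vf, div_eq_mul_inv]

theorem C_HPD {M a k α β : ℝ} {u : ℝ × ℝ → ℝ} {x : Fin 4 → ℝ}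
    {p q : ℝ} (h : HPD (Vf M a u) ![0, Vf M a u x * p, -q * Vf M a u x, 0] x) :
    HPD (Cf M a k α β u)
      ![α * Sf M a k α β u x, Cf M a k α β u x * p, -q * Cf M a k α β u x
        - α * a * Real.sin (x 2) * (Real.cos k / Real.sin k) * Sf M a k α β u x, 0] x := by
  refine (h.mul (HPD.comp (Real.hasDerivAt_cosh _) (Th_HPD a k α β x))).congr ?_
  intro μ; fin_cases μ <;> simp [Cf, Sf] <;> ring

theorem S_HPD {M a k α β : ℝ} {u : ℝ × ℝ → ℝ} {x : Fin 4 → ℝ}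
    {p q : ℝ} (h : HPD (Vf M a u) ![0, Vf M a u x * p, -q * Vf M a u x, 0] x) :
    HPD (Sf M a k α β u)
      ![α * Cf M a k α β u x, Sf M a k α β u x * p, -q * Sf M a k α β u x
        - α * a * Real.sin (x 2) * (Real.cos k / Real.sin k) * Cf M a k α β u x, 0] x := by
  refine (h.mul (HPD.comp (Real.hasDerivAt_sinh _) (Th_HPD a k α β x))).congr ?_
  intro μ; fin_cases μ <;> simp [Cf, Sf] <;> ring

theorem pd_asym {p q r s t w : (Fin 4 → ℝ) → ℝ} {dp dq dr ds dt dw x : Fin 4 → ℝ}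
    (hp : HPD p dp x) (hq : HPD q dq x) (hr : HPD r dr x) (hs : HPD s ds x) (ht : HPD t dt x)
    (hw : HPD w dw x) (μ i j : Fin 4) :
    pd μ (fun y => asym (p y) (q y) (r y) (s y) (t y) (w y) i j) x
      = asym (dp μ) (dq μ) (dr μ) (ds μ) (dt μ) (dw μ) i j := by
  have h0 := (HPD.const 0 x).2 μ
  fin_cases i <;> fin_cases j <;>
    first
    | exact h0
    | exact hp.2 μ | exact hp.neg.2 μ
    | exact hq.2 μ | exact hq.neg.2 μ
    | exact hr.2 μ | exact hr.neg.2 μ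
    | exact hs.2 μ | exact hs.neg.2 μ
    | exact ht.2 μ | exact ht.neg.2 μ
    | exact hw.2 μ | exact hw.neg.2 μ

theorem closed_asym {dp dq dr ds dt dw : Fin 4 → ℝ}
    (h012 : dp 2 + ds 0 - dq 1 = 0) (h013 : dp 3 + dt 0 - dr 1 = 0)
    (h023 : dq 3 + dw 0 - dr 2 = 0) (h123 : ds 3 + dw 1 - dt 2 = 0) (μ ν l : Fin 4) :
    asym (dp μ) (dq μ) (dr μ) (ds μ) (dt μ) (dw μ) ν l
      + asym (dp ν) (dq ν) (dr ν) (ds ν) (dt ν) (dw ν) l μ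
      + asym (dp l) (dq l) (dr l) (ds l) (dt l) (dw l) μ ν = 0 := by
  fin_cases μ <;> fin_cases ν <;> fin_cases l <;> simp [asym] <;> linarith

theorem closed_HPD {p q r s t w : (Fin 4 → ℝ) → ℝ} {dp dq dr ds dt dw x : Fin 4 → ℝ}
    (hp : HPD p dp x) (hq : HPD q dq x) (hr : HPD r dr x) (hs : HPD s ds x) (ht : HPD t dt x)
    (hw : HPD w dw x)
    (h012 : dp 2 + ds 0 - dq 1 = 0) (h013 : dp 3 + dt 0 - dr 1 = 0)
    (h023 : dq 3 + dw 0 - dr 2 = 0) (h123 : ds 3 + dw 1 - dt 2 = 0) (μ ν l : Fin 4) :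
    pd μ (fun y => asym (p y) (q y) (r y) (s y) (t y) (w y) ν l) x
      + pd ν (fun y => asym (p y) (q y) (r y) (s y) (t y) (w y) l μ) x
      + pd l (fun y => asym (p y) (q y) (r y) (s y) (t y) (w y) μ ν) x = 0 := by
  rw [pd_asym hp hq hr hs ht hw, pd_asym hp hq hr hs ht hw, pd_asym hp hq hr hs ht hw]
  exact closed_asym h012 h013 h023 h123 μ ν l

theorem div_HPD {p q r s t w : (Fin 4 → ℝ) → ℝ} {dp dq dr ds dt dw x J : Fin 4 → ℝ}
    (hp : HPD p dp x) (hq : HPD q dq x) (hr : HPD r dr x) (hs : HPD s ds x) (ht : HPD t dt x)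
    (hw : HPD w dw x)
    (h0 : dp 1 + dq 2 + dr 3 = J 0) (h1 : -dp 0 + ds 2 + dt 3 = J 1)
    (h2 : -dq 0 - ds 1 + dw 3 = J 2) (h3 : -dr 0 - dt 1 - dw 2 = J 3) (μ : Fin 4) :
    ∑ ν : Fin 4, pd ν (fun y => asym (p y) (q y) (r y) (s y) (t y) (w y) μ ν) x = J μ := by
  simp only [pd_asym hp hq hr hs ht hw, Fin.sum_univ_four]
  fin_cases μ <;> simp [asym] <;> linarith

theorem field_derivs {M a k α β : ℝ} (ha : 0 ≤ a) (haM : a < M)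
    (hk : Real.sin k ≠ 0) {u : ℝ × ℝ → ℝ} {x : Fin 4 → ℝ} (hx : x ∈ KerrExt M a)
    (h : HPD (fun y => u (y 1, y 2))
      ![0, u (x 1, x 2) * ((M - x 1 - α * (x 1 ^ 2 + a ^ 2)) / Del M a x),
        u (x 1, x 2) * (-(Real.cos (x 2) / Real.sin (x 2))), 0] x) (μ ν l : Fin 4) :
    pd μ (fun y => F10A M a k α β u y ν l) x + pd ν (fun y => F10A M a k α β u y l μ) x
      + pd l (fun y => F10A M a k α β u y μ ν) x = 0 := by
  have hV := V_HPD ha haM hx h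
  have hC := C_HPD (k := k) (α := α) (β := β) hV
  have hS := S_HPD (k := k) (α := α) (β := β) hV
  have hs := sin_HPD x
  have hD := del_HPD M a x
  have hR := rho2_HPD a x
  have hA := ra_HPD a x
  have hD0 := (del_pos ha haM hx).ne'
  have hS0 := (sin_pos_ext hx).ne'
  have hc : Real.cos (x 2) ^ 2 = 1 - Real.sin (x 2) ^ 2 := by
    have := Real.sin_sq_add_cos_sq (x 2); linarith
  have e1 : rho2 a x = x 1 ^ 2 + a ^ 2 * (1 - Real.sin (x 2) ^ 2) := by rw [rho2, hc]
  simp only [F10A_eq]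
  refine closed_HPD
    ((HPD.const (a * Real.sin k) x).mul (hs.mul hS))
    ((HPD.const (Real.cos k) x).mul (hD.mul hC))
    ((HPD.const (-Real.sin k) x).mul ((hD.mul hs).mul hC))
    ((HPD.const (-Real.cos k) x).mul (hR.mul hS))
    ((HPD.const (Real.sin k) x).mul ((hA.mul hs).mul hS))
    ((HPD.const (a * Real.cos k) x).mul ((hD.mul (hs.mul hs)).mul hC)) ?_ ?_ ?_ ?_ μ ν l
  all_goals clear hV hC hS hs hD hR hA h
  all_goals simp [e1]
  all_goals field_simp
  all_goals ring

theorem current_eq {M a k α β : ℝ} (ha : 0 ≤ a) (haM : a < M)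
    (hk : Real.sin k ≠ 0) {u : ℝ × ℝ → ℝ} {x : Fin 4 → ℝ} (hx : x ∈ KerrExt M a)
    (h : HPD (fun y => u (y 1, y 2))
      ![0, u (x 1, x 2) * ((M - x 1 - α * (x 1 ^ 2 + a ^ 2)) / Del M a x),
        u (x 1, x 2) * (-(Real.cos (x 2) / Real.sin (x 2))), 0] x) (μ : Fin 4) :
    ∑ ν : Fin 4, pd ν (fun y => rho2 a y * Real.sin (y 2) *
      ∑ i : Fin 4, ∑ j : Fin 4, (kerr M a y)⁻¹ μ i * (kerr M a y)⁻¹ ν j *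
        F10A M a k α β u y i j) x
      = (fun i => α * a * Real.sin (x 2) ^ 2 / Real.sin k *
        ![(x 1 ^ 2 + a ^ 2) * Sf M a k α β u x, Del M a x * Cf M a k α β u x, 0,
          a * Sf M a k α β u x] i) μ := by
  have hV := V_HPD ha haM hx h
  have hC := C_HPD (k := k) (α := α) (β := β) hV
  have hS := S_HPD (k := k) (α := α) (β := β) hV
  have hs := sin_HPD x
  have hD := del_HPD M a x
  have hR := rho2_HPD a x
  have hA := ra_HPD a x
  have hD0 := (del_pos ha haM hx).ne'
  have hS0 := (sin_pos_ext hx).ne'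
  have hc : Real.cos (x 2) ^ 2 = 1 - Real.sin (x 2) ^ 2 := by
    have := Real.sin_sq_add_cos_sq (x 2); linarith
  have eK : Real.cos k ^ 2 = 1 - Real.sin k ^ 2 := by
    have := Real.sin_sq_add_cos_sq k; linarith
  have e1 : rho2 a x = x 1 ^ 2 + a ^ 2 * (1 - Real.sin (x 2) ^ 2) := by rw [rho2, hc]
  rw [Finset.sum_congr rfl (fun ν _ => pd_congr
    (Filter.eventually_of_mem ((isOpen_kerrExt M a).mem_nhds hx)
      (fun y hy => dual_eq (k := k) (α := α) (β := β) ha haM u hy μ ν)) ν)]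
  refine div_HPD (J := fun i => α * a * Real.sin (x 2) ^ 2 / Real.sin k *
        ![(x 1 ^ 2 + a ^ 2) * Sf M a k α β u x, Del M a x * Cf M a k α β u x, 0,
          a * Sf M a k α β u x] i)
    ((HPD.const (-(a * Real.sin k)) x).mul ((hD.mul (hs.mul hs)).mul hS))
    ((HPD.const (-Real.cos k) x).mul ((hA.mul hs).mul hC))
    ((HPD.const (Real.sin k) x).mul (hR.mul hC))
    ((HPD.const (-Real.cos k) x).mul ((hD.mul hs).mul hS))
    ((HPD.const (Real.sin k) x).mul (hD.mul hS))
    ((HPD.const (a * Real.cos k) x).mul (hs.mul hC)) ?_ ?_ ?_ ?_ μ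
  all_goals clear hV hC hS hs hD hR hA h
  all_goals simp [e1]
  all_goals field_simp
  all_goals try simp only [eK]
  all_goals ring_nf
  all_goals try simp only [eK]
  all_goals ring

theorem field_current {M a k α β : ℝ} (ha : 0 ≤ a) (haM : a < M)
    (hk : Real.sin k ≠ 0) {u : ℝ × ℝ → ℝ} {x : Fin 4 → ℝ} (hx : x ∈ KerrExt M a)
    (h : HPD (fun y => u (y 1, y 2))
      ![0, u (x 1, x 2) * ((M - x 1 - α * (x 1 ^ 2 + a ^ 2)) / Del M a x),
        u (x 1, x 2) * (-(Real.cos (x 2) / Real.sin (x 2))), 0] x) (μ : Fin 4) :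
    ∑ ν : Fin 4, F10A M a k α β u x μ ν * current M a (F10A M a k α β u) x ν = 0 := by
  have hc : Real.cos (x 2) ^ 2 = 1 - Real.sin (x 2) ^ 2 := by
    have := Real.sin_sq_add_cos_sq (x 2); linarith
  have e1 : rho2 a x = x 1 ^ 2 + a ^ 2 * (1 - Real.sin (x 2) ^ 2) := by rw [rho2, hc]
  simp only [current, current_eq ha haM hk hx h]
  rw [F10A_eq]
  generalize (rho2 a x * Real.sin (x 2))⁻¹ = W
  rw [e1]
  fin_cases μ
  all_goals simp [asym, Fin.sum_univ_four]
  all_goals ring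

theorem field_sq {M a k α β : ℝ} (ha : 0 ≤ a) (haM : a < M)
    (u : ℝ × ℝ → ℝ) {x : Fin 4 → ℝ} (hx : x ∈ KerrExt M a) :
    Fsq M a (F10A M a k α β u) x = -2 * u (x 1, x 2) ^ 2 := by
  have hD0 := (del_pos ha haM hx).ne'
  have hS0 := (sin_pos_ext hx).ne'
  have hR0 := (rho2_pos ha haM hx).ne'
  have hc : Real.cos (x 2) ^ 2 = 1 - Real.sin (x 2) ^ 2 := by
    have := Real.sin_sq_add_cos_sq (x 2); linarith
  have e1 : rho2 a x = x 1 ^ 2 + a ^ 2 * (1 - Real.sin (x 2) ^ 2) := by rw [rho2, hc]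
  have eV : u (x 1, x 2) ^ 2 = Del M a x * Vf M a u x ^ 2 := by
    have hq : Real.sqrt (Del M a x) ^ 2 = Del M a x := Real.sq_sqrt (del_pos ha haM hx).le
    rw [Vf, div_pow, hq]; field_simp
  have eC : Cf M a k α β u x ^ 2 = Vf M a u x ^ 2 + Sf M a k α β u x ^ 2 := by
    have := Real.cosh_sq (ThA a k α β x)
    rw [Cf, Sf, mul_pow, mul_pow, this]; ring
  have eK : Real.cos k ^ 2 = 1 - Real.sin k ^ 2 := by
    have := Real.sin_sq_add_cos_sq k; linarith
  have H : (rho2 a x * Real.sin (x 2)) * Fsq M a (F10A M a k α β u) x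
      = ∑ μ : Fin 4, ∑ ν : Fin 4, (rho2 a x * Real.sin (x 2) *
        ∑ i : Fin 4, ∑ j : Fin 4, (kerr M a x)⁻¹ μ i * (kerr M a x)⁻¹ ν j *
          F10A M a k α β u x i j) * F10A M a k α β u x μ ν := by
    unfold Fsq
    simp only [Finset.mul_sum, Finset.sum_mul, mul_assoc]
  simp only [dual_eq ha haM u hx] at H
  apply mul_left_cancel₀ (mul_ne_zero hR0 hS0)
  rw [H, F10A_eq, eV]
  simp [asym, Fin.sum_univ_four]
  have eV2 : Vf M a u x ^ 2 = Cf M a k α β u x ^ 2 - Sf M a k α β u x ^ 2 := by linarith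
  rw [eV2, e1]
  generalize Del M a x = D at *
  generalize Real.sin (x 2) = s at *
  generalize Sf M a k α β u x = S at *
  generalize Cf M a k α β u x = C at *
  generalize Real.sin k = sk at *
  generalize Real.cos k = ck at *
  linear_combination (-2 * D * s * (x 1 ^ 2 + a ^ 2 * (1 - s ^ 2)) * (C ^ 2 - S ^ 2)) * eK

/-- F₁₀A is closed and force-free on U, and F₁₀A² = −2u², so F₁₀A is
electrically dominated. -/
theorem kerr_F10A_forcefree (M a k α β : ℝ) (ha : 0 ≤ a) (haM : a < M)
    (hk : Real.sin k ≠ 0)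
    (u : ℝ × ℝ → ℝ)
    (hu : ContDiffOn ℝ 2 u
      (Set.Ioi (M + Real.sqrt (M ^ 2 - a ^ 2)) ×ˢ Set.Ioo 0 Real.pi))
    (hupos : ∀ p ∈ Set.Ioi (M + Real.sqrt (M ^ 2 - a ^ 2)) ×ˢ Set.Ioo 0 Real.pi,
      0 < u p)
    (hur : ∀ p ∈ Set.Ioi (M + Real.sqrt (M ^ 2 - a ^ 2)) ×ˢ Set.Ioo 0 Real.pi,
      fderiv ℝ u p (1, 0)
        = u p * ((M - p.1 - α * (p.1 ^ 2 + a ^ 2)) / (p.1 ^ 2 - 2 * M * p.1 + a ^ 2)))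
    (hut : ∀ p ∈ Set.Ioi (M + Real.sqrt (M ^ 2 - a ^ 2)) ×ˢ Set.Ioo 0 Real.pi,
      fderiv ℝ u p (0, 1) = u p * (-(Real.cos p.2 / Real.sin p.2))) :
    Closed2Form (F10A M a k α β u) (KerrExt M a) ∧
    ForceFree M a (F10A M a k α β u) (KerrExt M a) ∧
    ∀ x ∈ KerrExt M a, Fsq M a (F10A M a k α β u) x = -2 * u (x 1, x 2) ^ 2 := by
  have h := fun (x : Fin 4 → ℝ) (hx : x ∈ KerrExt M a) => u_HPD hu hur hut hx
  refine ⟨fun x hx μ ν l => field_derivs ha haM hk hx (h x hx) μ ν l,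
    fun x hx μ => field_current ha haM hk hx (h x hx) μ,
    fun x hx => field_sq ha haM u hx⟩
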